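/- arXiv:2501.06279 — 3 statements merged into one kernel-verified Lean document; each statement's English description precedes it below -/
import Mathlib

section
/- For every objective j ∈ {1,…,m}, there exists a portfolio q¹ that is cost-efficient in the non-informative weight set S⁰ such that E_j(q¹) ≥ E_j(q²) for every portfolio q² ∈ Q that is not cost-efficient in S⁰. -/
open Finset

noncomputable section

/-- The non-informative weight set: the standard simplex in `ℝ^m`. -/
def S0 (m : ℕ) : Set (Fin m → ℝ) :=
  {w | (∀ j, 0 ≤ w j) ∧ ∑ j, w j = 1}

/-- Expected overall utility `U(q,w) = ∑ j, w_j E_j(q)`. -/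
def U {P : Type*} {m : ℕ} (E : P → Fin m → ℝ) (q : P) (w : Fin m → ℝ) : ℝ :=
  ∑ j, w j * E q j

/-- `Dominates E S q2 q1` : portfolio `q2` dominates portfolio `q1` in the weight set `S`. -/
def Dominates {P : Type*} {m : ℕ} (E : P → Fin m → ℝ) (S : Set (Fin m → ℝ))
    (q2 q1 : P) : Prop :=
  (∀ w ∈ S, U E q1 w ≤ U E q2 w) ∧ ∃ w ∈ S, U E q1 w < U E q2 w

/-- `EquivIn E S q1 q2` : portfolios `q1` and `q2` are `S`-equivalent. -/
def EquivIn {P : Type*} {m : ℕ} (E : P → Fin m → ℝ) (S : Set (Fin m → ℝ))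
    (q1 q2 : P) : Prop :=
  ∀ w ∈ S, U E q1 w = U E q2 w

/-- `CostEffWrt E c S q1 q2` : portfolio `q1` is cost-efficient with respect to `q2` in `S`. -/
def CostEffWrt {P : Type*} {m : ℕ} (E : P → Fin m → ℝ) (c : P → ℝ)
    (S : Set (Fin m → ℝ)) (q1 q2 : P) : Prop :=
  (Dominates E S q1 q2 ∧ c q1 ≤ c q2) ∨ (EquivIn E S q1 q2 ∧ c q1 < c q2)

/-- `CostEfficient E c Q S q` : portfolio `q` is cost-efficient in `S`
(no portfolio in `Q` is cost-efficient with respect to `q` in `S`). -/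
def CostEfficient {P : Type*} {m : ℕ} (E : P → Fin m → ℝ) (c : P → ℝ)
    (Q : Finset P) (S : Set (Fin m → ℝ)) (q : P) : Prop :=
  ¬ ∃ q' ∈ Q, CostEffWrt E c S q' q

theorem costEffWrt_iff {P : Type*} {m : ℕ} (E : P → Fin m → ℝ) (c : P → ℝ)
    (S : Set (Fin m → ℝ)) (q1 q2 : P) :
    CostEffWrt E c S q1 q2 ↔
      ((fun w : S => U E q2 w), -c q2) < ((fun w : S => U E q1 w), -c q1) := by
  rw [Prod.lt_iff]
  simp only [CostEffWrt, Dominates, EquivIn, Pi.lt_def, Pi.le_def, Subtype.forall,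
    Subtype.exists, exists_prop, neg_le_neg_iff, neg_lt_neg_iff]
  constructor
  · rintro (h | ⟨h, hc⟩)
    · exact Or.inl h
    · exact Or.inr ⟨fun w hw => (h w hw).ge, hc⟩
  · rintro (h | ⟨h, hc⟩)
    · exact Or.inl h
    · by_cases hw : ∃ w ∈ S, U E q2 w < U E q1 w
      · exact Or.inl ⟨⟨h, hw⟩, hc.le⟩
      · push Not at hw
        exact Or.inr ⟨fun w hS => le_antisymm (hw w hS) (h w hS), hc⟩

theorem single_mem_S0 {m : ℕ} (j : Fin m) : Pi.single j 1 ∈ S0 m :=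
  ⟨fun i => by by_cases h : i = j <;> simp [h], by simp⟩

theorem U_single {P : Type*} {m : ℕ} (E : P → Fin m → ℝ) (q : P) (j : Fin m) :
    U E q (Pi.single j 1) = E q j := by
  simp [U, Pi.single_apply]

/-- For every objective `j`, there is a portfolio `q1 ∈ Q` that is cost-efficient in the
non-informative set `S⁰` and satisfies `E_j(q1) ≥ E_j(q2)` for every portfolio
`q2 ∈ Q` that is not cost-efficient in `S⁰`. -/
theorem stmt0 {P : Type*} {m : ℕ} (Q : Finset P) (hQ : Q.Nonempty)
    (c : P → ℝ) (E : P → Fin m → ℝ) (j : Fin m) :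
    ∃ q1 ∈ Q, CostEfficient E c Q (S0 m) q1 ∧
      ∀ q2 ∈ Q, ¬ CostEfficient E c Q (S0 m) q2 → E q2 j ≤ E q1 j := by
  obtain ⟨q0, hq0, hmax⟩ := Q.exists_max_image (fun q => E q j) hQ
  obtain ⟨q1, hq1, hq1max⟩ := (Q.filter fun q => E q0 j ≤ E q j).exists_maximalFor
    (fun q => ((fun w : S0 m => U E q w), -c q)) ⟨q0, by simp [hq0]⟩
  rw [Finset.mem_filter] at hq1
  refine ⟨q1, hq1.1, ?_, fun q2 hq2 _ => (hmax q2 hq2).trans hq1.2⟩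
  rintro ⟨q, hq, h⟩
  rw [costEffWrt_iff] at h
  have hj : E q1 j ≤ E q j := by
    simpa only [U_single] using h.le.1 ⟨Pi.single j 1, single_mem_S0 j⟩
  exact h.not_ge (hq1max (Finset.mem_filter.2 ⟨hq, hq1.2.trans hj⟩) h.le)
end
end

section
/- Let S ⊆ S⁰ be a weight set and let j ∈ {1,…,m} be such that the j-th canonical weight vector e_j belongs to S. Then there exists a portfolio q that is cost-efficient in S and attains the maximum performance on objective j, i.e., E_j(q) ≥ E_j(q') for every portfolio q' ∈ Q. -/
open Finset

noncomputable section

/-- The `j`-th canonical weight vector. -/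
def canonical (m : ℕ) (j : Fin m) : Fin m → ℝ := fun i => if i = j then 1 else 0

lemma U_canonical {P : Type*} {m : ℕ} (E : P → Fin m → ℝ) (q : P) (j : Fin m) :
    U E q (canonical m j) = E q j := by
  simp [U, canonical]

/-- Utilities on `S` together with the negated cost; improving on a portfolio in the sense of
`CostEffWrt` strictly increases this profile in the product order. -/
def profile {P : Type*} {m : ℕ} (E : P → Fin m → ℝ) (c : P → ℝ) (S : Set (Fin m → ℝ))
    (q : P) : (S → ℝ) × ℝ :=
  (fun w => U E q w, -c q)

lemma profile_le_iff {P : Type*} {m : ℕ} {E : P → Fin m → ℝ} {c : P → ℝ}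
    {S : Set (Fin m → ℝ)} {q q' : P} :
    profile E c S q ≤ profile E c S q' ↔ (∀ w ∈ S, U E q w ≤ U E q' w) ∧ c q' ≤ c q := by
  simp [profile, Prod.le_def, Pi.le_def]

lemma CostEffWrt.profile_lt {P : Type*} {m : ℕ} {E : P → Fin m → ℝ} {c : P → ℝ}
    {S : Set (Fin m → ℝ)} {q q' : P} (h : CostEffWrt E c S q' q) :
    profile E c S q < profile E c S q' := by
  rw [lt_iff_le_not_ge, profile_le_iff, profile_le_iff]
  rcases h with ⟨⟨hle, w, hw, hlt⟩, hc⟩ | ⟨heq, hc⟩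
  · exact ⟨⟨hle, hc⟩, fun h => (h.1 w hw).not_gt hlt⟩
  · exact ⟨⟨fun w hw => (heq w hw).ge, hc.le⟩, fun h => h.2.not_gt hc⟩

/-- If the canonical vector `e_j` belongs to the weight set `S ⊆ S⁰`, then there is a
portfolio `q ∈ Q` that is cost-efficient in `S` and attains the maximum performance
on objective `j`. -/
theorem stmt2 {P : Type*} {m : ℕ} (Q : Finset P) (hQ : Q.Nonempty)
    (c : P → ℝ) (E : P → Fin m → ℝ)
    (S : Set (Fin m → ℝ)) (hS : S ⊆ S0 m) (j : Fin m) (hj : canonical m j ∈ S) :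
    ∃ q ∈ Q, CostEfficient E c Q S q ∧ ∀ q' ∈ Q, E q' j ≤ E q j := by
  classical
  obtain ⟨q₀, hq₀, hmax⟩ := Q.exists_max_image (fun q => E q j) hQ
  obtain ⟨_, hle, hM⟩ := (Q.image (profile E c S)).exists_le_maximal
    (mem_image_of_mem _ hq₀)
  obtain ⟨q, hq, rfl⟩ := mem_image.1 hM.prop
  refine ⟨q, hq, ?_, fun q' hq' => (hmax q' hq').trans ?_⟩
  · rintro ⟨q', hq', h⟩
    exact hM.not_gt (mem_image_of_mem _ hq') h.profile_lt
  · simpa only [U_canonical] using (profile_le_iff.1 hle).1 _ hj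
end
end

section
/- Let q ∈ {0,1}^h be a portfolio, let l ∈ {0,1,…,h}, and define the extended portfolio q^a by q^a_y = q_y for all y ≤ l and q^a_y = 1 for all y > l. If the failure-probability map is antitone in the portfolio (q ≤ q' componentwise implies p_k(q') ≤ p_k(q) for every node k) and the utility function u : {0,1}^n → ℝ is coherent, then for every portfolio q' ∈ {0,1}^h with q'_y = q_y for all y ≤ l, the expected utility satisfies E_{p(q')}[u] ≤ E_{p(q^a)}[u]; that is, the extended portfolio q^a provides an upper bound on the expected utility achievable by any extension of q. -/
open Finset

noncomputable section

/-- Probability of network state `x ∈ {0,1}^n` under independent node failure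
probabilities `p` : `P_p(x) = ∏ k, (x_k (1 - p_k) + (1 - x_k) p_k)`. -/
def stateProb {n : ℕ} (p : Fin n → ℝ) (x : Fin n → Bool) : ℝ :=
  ∏ k, if x k then (1 - p k) else p k

/-- Expected value of a utility function `u` on network states under failure
probabilities `p`. -/
def expUtil {n : ℕ} (p : Fin n → ℝ) (u : (Fin n → Bool) → ℝ) : ℝ :=
  ∑ x : Fin n → Bool, stateProb p x * u x

theorem expUtil_succ {n : ℕ} (p : Fin (n + 1) → ℝ) (u : (Fin (n + 1) → Bool) → ℝ) :
    expUtil p u = (1 - p 0) * expUtil (Fin.tail p) (fun x => u (Fin.cons true x)) +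
      p 0 * expUtil (Fin.tail p) (fun x => u (Fin.cons false x)) := by
  unfold expUtil stateProb
  rw [← (Fin.consEquiv (fun _ => Bool)).sum_comp, Fintype.sum_prod_type, Fintype.sum_bool]
  simp only [Fin.consEquiv_apply, Fin.prod_univ_succ, Fin.cons_zero, Fin.cons_succ,
    if_true, Bool.false_eq_true, if_false, Finset.mul_sum, mul_assoc, Fin.tail]
  rfl

theorem expUtil_mono_utility {n : ℕ} {p : Fin n → ℝ} (hp : ∀ k, p k ∈ Set.Icc (0 : ℝ) 1)
    {u v : (Fin n → Bool) → ℝ} (huv : ∀ x, u x ≤ v x) : expUtil p u ≤ expUtil p v := by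
  refine Finset.sum_le_sum fun x _ => mul_le_mul_of_nonneg_left (huv x) ?_
  refine Finset.prod_nonneg fun k _ => ?_
  split_ifs
  · exact sub_nonneg.2 (hp k).2
  · exact (hp k).1

/-- The expected value of a coherent utility is antitone in the failure probabilities. -/
theorem expUtil_antitone {n : ℕ} {p p' : Fin n → ℝ} (hp : ∀ k, p k ∈ Set.Icc (0 : ℝ) 1)
    (hp' : ∀ k, p' k ∈ Set.Icc (0 : ℝ) 1) (hle : ∀ k, p' k ≤ p k)
    {u : (Fin n → Bool) → ℝ} (hu : Monotone u) : expUtil p u ≤ expUtil p' u := by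
  induction n with
  | zero => simp [expUtil, stateProb]
  | succ n ih =>
    have hcons (b : Bool) : expUtil (Fin.tail p) (fun x => u (Fin.cons b x)) ≤
        expUtil (Fin.tail p') (fun x => u (Fin.cons b x)) :=
      ih (fun k => hp k.succ) (fun k => hp' k.succ) (fun k => hle k.succ)
        fun x y hxy => hu (Fin.cons_le_cons.2 ⟨le_rfl, hxy⟩)
    have hswitch : expUtil (Fin.tail p') (fun x => u (Fin.cons false x)) ≤
        expUtil (Fin.tail p') (fun x => u (Fin.cons true x)) :=
      expUtil_mono_utility (fun k => hp' k.succ)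
        fun x => hu (Fin.cons_le_cons.2 ⟨Bool.false_le _, le_rfl⟩)
    rw [expUtil_succ, expUtil_succ]
    have h₁ := mul_le_mul_of_nonneg_left (hcons true) (sub_nonneg.2 (hp 0).2)
    have h₂ := mul_le_mul_of_nonneg_left (hcons false) (hp 0).1
    have h₃ := mul_nonneg (sub_nonneg.2 (hle 0)) (sub_nonneg.2 hswitch)
    linarith

/-- The extended portfolio `q^a` (keeping the first `l` decisions of `q` and implementing
all remaining actions) gives an upper bound on the expected utility achievable by any
portfolio `q'` agreeing with `q` on the first `l` actions, provided the
failure-probability map is antitone in the portfolio and the utility is coherent. -/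
theorem stmt7 {n h : ℕ}
    (pmap : (Fin h → Bool) → Fin n → ℝ)
    (hrange : ∀ q k, pmap q k ∈ Set.Icc (0 : ℝ) 1)
    (hanti : ∀ q q' : Fin h → Bool, (∀ y, q y ≤ q' y) → ∀ k, pmap q' k ≤ pmap q k)
    (u : (Fin n → Bool) → ℝ)
    (hu : ∀ x y : Fin n → Bool, (∀ k, x k ≤ y k) → u x ≤ u y)
    (q : Fin h → Bool) (l : ℕ) (hl : l ≤ h)
    (qa : Fin h → Bool) (hqa : ∀ y : Fin h, qa y = if (y : ℕ) < l then q y else true)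
    (q' : Fin h → Bool) (hq' : ∀ y : Fin h, (y : ℕ) < l → q' y = q y) :
    expUtil (pmap q') u ≤ expUtil (pmap qa) u := by
  refine expUtil_antitone (hrange q') (hrange qa) (hanti q' qa fun y => ?_) fun x y => hu x y
  rw [hqa y]
  split_ifs with hy
  · exact (hq' y hy).le
  · exact Bool.le_true _
end
end
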